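/- arXiv:2303.17030 — 6 statements merged into one kernel-verified Lean document; each statement's English description precedes it below -/
import Mathlib

section
/- For every real number q with q > -1/2 and q ≠ 0, the function x ↦ (1 − exp(−q·x))·ρ(x) is Lebesgue-integrable on (0, ∞) and ∫₀^∞ (1 − exp(−q·x))·ρ(x) dx = 2√2 · Γ(q + 1/2)/Γ(q), where Γ denotes the real Gamma function. -/
open MeasureTheory Real

/-- The density of the Lévy measure `Λ` of the subordinator in the Lamperti
representation of the tagged fragment of the Brownian excursion fragmentation:
`ρ(x) = 2·exp(x)/√(2π·(exp(x) − 1)³)`. -/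
noncomputable def levyDensity (x : ℝ) : ℝ :=
  2 * Real.exp x / Real.sqrt (2 * Real.pi * (Real.exp x - 1) ^ 3)

open Filter Topology Set ProbabilityTheory in
theorem integrableOn_and_integral_rpow_mul_one_sub_rpow {a b : ℝ} (ha : 0 < a) (hb : 0 < b) :
    IntegrableOn (fun x : ℝ => x ^ (a - 1) * (1 - x) ^ (b - 1)) (Ioo 0 1) ∧
    ∫ x in Ioo (0 : ℝ) 1, x ^ (a - 1) * (1 - x) ^ (b - 1) = beta a b := by
  have hc : IntegrableOn (fun x : ℝ => (x : ℂ) ^ ((a : ℂ) - 1) * (1 - (x : ℂ)) ^ ((b : ℂ) - 1))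
      (Ioc 0 1) := by
    rw [← intervalIntegrable_iff_integrableOn_Ioc_of_le zero_le_one]
    exact Complex.betaIntegral_convergent (by simpa) (by simpa)
  have hre : ∀ x ∈ Ioc (0 : ℝ) 1,
      RCLike.re ((x : ℂ) ^ ((a : ℂ) - 1) * (1 - (x : ℂ)) ^ ((b : ℂ) - 1)) =
        x ^ (a - 1) * (1 - x) ^ (b - 1) := by
    rintro x ⟨hx1, hx2⟩
    norm_cast
    rw [← Complex.ofReal_cpow, ← Complex.ofReal_cpow, RCLike.re_to_complex,
      Complex.re_mul_ofReal, Complex.ofReal_re]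
    all_goals linarith
  constructor
  · exact ((IntegrableOn.congr_fun (Integrable.re hc) hre measurableSet_Ioc)).mono_set
      Ioo_subset_Ioc_self
  · rw [beta_eq_betaIntegralReal a b ha hb, Complex.betaIntegral,
      intervalIntegral.integral_of_le zero_le_one, ← integral_Ioc_eq_integral_Ioo,
      ← RCLike.re_to_complex, ← integral_re hc]
    exact setIntegral_congr_fun measurableSet_Ioc fun x hx => (hre x hx).symm

theorem sqrt_exp_sub_one (x : ℝ) : √(exp x - 1) = exp (x / 2) * √(1 - exp (-x)) := by
  have h : exp x - 1 = exp (x / 2) ^ 2 * (1 - exp (-x)) := by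
    rw [← exp_nat_mul, mul_sub, ← exp_add]
    congr 1
    · simp; ring
    · rw [← exp_zero]; congr 1; push_cast; ring
  rw [h, sqrt_mul (sq_nonneg _), sqrt_sq (exp_pos _).le]

open Filter Topology Set ProbabilityTheory in
theorem integrableOn_and_integral_exp_div_sqrt {q : ℝ} (hq : -(1 / 2) < q) :
    IntegrableOn (fun x => exp (-q * x) / √(exp x - 1)) (Ioi 0) ∧
    ∫ x in Ioi (0 : ℝ), exp (-q * x) / √(exp x - 1) = beta (q + 1 / 2) (1 / 2) := by
  have him : (fun x : ℝ => exp (-x)) '' Ioi 0 = Ioo 0 1 := by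
    ext y
    constructor
    · rintro ⟨x, hx, rfl⟩
      exact ⟨exp_pos _, by simpa using hx⟩
    · rintro ⟨h0, h1⟩
      exact ⟨-log y, by simpa using log_neg h0 h1, by simp [exp_log h0]⟩
  have hd : ∀ x ∈ Ioi (0 : ℝ),
      HasDerivWithinAt (fun x : ℝ => exp (-x)) (-exp (-x)) (Ioi 0) x := fun x _ => by
    simpa using (hasDerivAt_neg x).exp.hasDerivWithinAt
  have hinj : InjOn (fun x : ℝ => exp (-x)) (Ioi 0) := fun x _ y _ h => by simpa using h
  have heq : ∀ x ∈ Ioi (0 : ℝ), |-exp (-x)| •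
      ((exp (-x)) ^ (q + 1 / 2 - 1) * (1 - exp (-x)) ^ ((1 / 2 : ℝ) - 1)) =
        exp (-q * x) / √(exp x - 1) := by
    intro x hx
    have h1 : 0 < 1 - exp (-x) := by simpa using hx
    rw [abs_neg, abs_of_pos (exp_pos _), smul_eq_mul, sqrt_exp_sub_one, ← exp_mul,
      show (1 / 2 : ℝ) - 1 = -(1 / 2) by norm_num, rpow_neg h1.le, ← sqrt_eq_rpow,
      ← mul_assoc, ← exp_add, ← div_div, ← exp_sub, ← div_eq_mul_inv]
    congr 2
    ring
  obtain ⟨hi, hv⟩ := integrableOn_and_integral_rpow_mul_one_sub_rpow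
    (a := q + 1 / 2) (b := 1 / 2) (by linarith) (by norm_num)
  rw [← him] at hi hv
  rw [integrableOn_image_iff_integrableOn_abs_deriv_smul measurableSet_Ioi hd hinj] at hi
  rw [integral_image_eq_integral_abs_deriv_smul measurableSet_Ioi hd hinj] at hv
  exact ⟨hi.congr_fun heq measurableSet_Ioi,
    (setIntegral_congr_fun measurableSet_Ioi heq).symm.trans hv⟩

open Filter Topology in
theorem tendsto_one_sub_exp_div_sqrt_atTop {q : ℝ} (hq : -(1 / 2) < q) :
    Tendsto (fun x => (1 - exp (-q * x)) / √(exp x - 1)) atTop (𝓝 0) := by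
  have h1 : Tendsto (fun x : ℝ => exp (-(1 / 2) * x)) atTop (𝓝 0) :=
    tendsto_exp_atBot.comp (tendsto_id.const_mul_atTop_of_neg (by norm_num))
  have h2 : Tendsto (fun x : ℝ => exp (-(q + 1 / 2) * x)) atTop (𝓝 0) :=
    tendsto_exp_atBot.comp (tendsto_id.const_mul_atTop_of_neg (by linarith))
  have h3 : Tendsto (fun x : ℝ => √(1 - exp (-x))) atTop (𝓝 1) := by
    have := (tendsto_exp_neg_atTop_nhds_zero.const_sub 1).sqrt
    simpa using this
  have h := (h1.sub h2).div h3 one_ne_zero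
  simp only [sub_zero, zero_div] at h
  refine h.congr fun x => ?_
  simp only [Pi.div_apply]
  rw [sqrt_exp_sub_one, ← div_div, sub_div 1, ← exp_sub, one_div (exp _), ← exp_neg]
  congr 3 <;> ring_nf

open Filter Topology Set in
theorem continuousWithinAt_one_sub_exp_div_sqrt (q : ℝ) :
    ContinuousWithinAt (fun x => (1 - exp (-q * x)) / √(exp x - 1)) (Ici 0) 0 := by
  have hO : (fun x => 1 - exp (-q * x)) =O[𝓝 0] fun x => x := by
    have hd : DifferentiableAt ℝ (fun x => 1 - exp (-q * x)) 0 := by fun_prop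
    simpa using hd.isBigO_sub
  obtain ⟨C, hC⟩ := hO.bound
  have hlim : Tendsto (fun x => |C| * √(exp x - 1)) (𝓝[Ici 0] (0 : ℝ)) (𝓝 0) := by
    have : Continuous fun x => |C| * √(exp x - 1) := by fun_prop
    simpa using (this.tendsto 0).mono_left nhdsWithin_le_nhds
  rw [ContinuousWithinAt]
  simp only [mul_zero, exp_zero, sub_self, zero_div]
  refine squeeze_zero_norm' ?_ hlim
  filter_upwards [nhdsWithin_le_nhds hC, self_mem_nhdsWithin] with x hx hx0
  have hx0 : 0 ≤ x := hx0
  rw [norm_div, norm_of_nonneg (sqrt_nonneg _)]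
  have hle : x ≤ exp x - 1 := by linarith [add_one_le_exp x]
  refine div_le_of_le_mul₀ (sqrt_nonneg _) (by positivity) ?_
  rw [mul_assoc, mul_self_sqrt (hx0.trans hle)]
  rw [norm_of_nonneg hx0] at hx
  exact hx.trans (mul_le_mul (le_abs_self C) hle hx0 (abs_nonneg C))

theorem hasDerivAt_one_sub_exp_div_sqrt (q : ℝ) {x : ℝ} (hx : 0 < x) :
    HasDerivAt (fun x => (1 - exp (-q * x)) / √(exp x - 1))
      (q * (exp (-q * x) / √(exp x - 1)) -
        (1 - exp (-q * x)) * (exp x / (2 * (exp x - 1) * √(exp x - 1)))) x := by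
  have hpos : 0 < exp x - 1 := by simpa using hx
  have hs : √(exp x - 1) ≠ 0 := (sqrt_pos.2 hpos).ne'
  have h1 : HasDerivAt (fun x => 1 - exp (-q * x)) (-(exp (-q * x) * (-q * 1))) x :=
    (((hasDerivAt_id x).const_mul (-q)).exp).const_sub 1
  have h2 := ((hasDerivAt_exp x).sub_const 1).sqrt hpos.ne'
  refine (h1.div h2 hs).congr_deriv ?_
  have hsq : √(exp x - 1) ^ 2 = exp x - 1 := sq_sqrt hpos.le
  generalize √(exp x - 1) = s at *
  rw [← hsq]
  field_simp

theorem levyDensity_eq {x : ℝ} (hx : 0 < x) :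
    levyDensity x = 4 / √(2 * π) * (exp x / (2 * (exp x - 1) * √(exp x - 1))) := by
  have hpos : 0 < exp x - 1 := by simpa using hx
  have h : (exp x - 1) ^ 3 = (exp x - 1) ^ 2 * (exp x - 1) := by ring
  have hs : √(exp x - 1) ≠ 0 := (sqrt_pos.2 hpos).ne'
  have hp : √(2 * π) ≠ 0 := by positivity
  rw [levyDensity, sqrt_mul (x := 2 * π) (by positivity), h,
    sqrt_mul (x := (exp x - 1) ^ 2) (by positivity), sqrt_sq hpos.le]
  field_simp
  ring

open Filter Topology Set ProbabilityTheory in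
theorem integrableOn_and_integral_one_sub_exp_mul {q : ℝ} (hq : -(1 / 2) < q) :
    IntegrableOn (fun x => (1 - exp (-q * x)) * (exp x / (2 * (exp x - 1) * √(exp x - 1))))
      (Ioi 0) ∧
    ∫ x in Ioi (0 : ℝ), (1 - exp (-q * x)) * (exp x / (2 * (exp x - 1) * √(exp x - 1))) =
      q * beta (q + 1 / 2) (1 / 2) := by
  obtain ⟨hi, hv⟩ := integrableOn_and_integral_exp_div_sqrt hq
  set g : ℝ → ℝ := fun x => exp (-q * x) / √(exp x - 1) with hg
  set H : ℝ → ℝ := fun x => (1 - exp (-q * x)) / √(exp x - 1) with hH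
  have hgi : Integrable g := by
    refine (integrableOn_iff_integrable_of_support_subset fun x hx => ?_).1 hi
    by_contra h
    refine hx ?_
    have : exp x - 1 ≤ 0 := by simpa using h
    simp [hg, sqrt_eq_zero_of_nonpos this]
  have hmeas : Measurable g := by fun_prop
  let G : ℝ → ℝ := fun x => q * (∫ t in (0 : ℝ)..x, g t) - H x
  have hcont : ContinuousWithinAt G (Ici 0) 0 :=
    ((hgi.continuous_primitive 0).const_mul q).continuousWithinAt.sub
      (continuousWithinAt_one_sub_exp_div_sqrt q)
  have hderiv : ∀ x ∈ Ioi (0 : ℝ), HasDerivAt G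
      ((1 - exp (-q * x)) * (exp x / (2 * (exp x - 1) * √(exp x - 1)))) x := by
    intro x hx
    have hpos : 0 < exp x - 1 := by simpa using hx
    have hc : ContinuousAt g x :=
      ContinuousAt.div (by fun_prop) (by fun_prop) (sqrt_pos.2 hpos).ne'
    have h1 := intervalIntegral.integral_hasDerivAt_right (hgi.intervalIntegrable (a := 0))
      (hmeas.stronglyMeasurable.stronglyMeasurableAtFilter) hc
    refine ((h1.const_mul q).sub (hasDerivAt_one_sub_exp_div_sqrt q hx)).congr_deriv ?_
    simp only [hg]
    ring
  have hlim : Tendsto G atTop (𝓝 (q * beta (q + 1 / 2) (1 / 2))) := by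
    rw [← hv, ← sub_zero (q * _)]
    exact ((intervalIntegral_tendsto_integral_Ioi 0 hi tendsto_id).const_mul q).sub
      (tendsto_one_sub_exp_div_sqrt_atTop hq)
  have hG0 : G 0 = 0 := by simp [G, hH]
  have hw : ∀ x ∈ Ioi (0 : ℝ), 0 ≤ exp x / (2 * (exp x - 1) * √(exp x - 1)) := by
    intro x hx
    have hpos : 0 < exp x - 1 := by simpa using hx
    positivity
  rcases le_total 0 q with h | h
  · have hnn : ∀ x ∈ Ioi (0 : ℝ),
        0 ≤ (1 - exp (-q * x)) * (exp x / (2 * (exp x - 1) * √(exp x - 1))) := by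
      intro x hx
      refine mul_nonneg (sub_nonneg.2 (exp_le_one_iff.2 ?_)) (hw x hx)
      nlinarith [mem_Ioi.1 hx]
    refine ⟨integrableOn_Ioi_deriv_of_nonneg hcont hderiv hnn hlim, ?_⟩
    rw [integral_Ioi_of_hasDerivAt_of_nonneg hcont hderiv hnn hlim, hG0, sub_zero]
  · have hnp : ∀ x ∈ Ioi (0 : ℝ),
        (1 - exp (-q * x)) * (exp x / (2 * (exp x - 1) * √(exp x - 1))) ≤ 0 := by
      intro x hx
      refine mul_nonpos_of_nonpos_of_nonneg (sub_nonpos.2 (one_le_exp ?_)) (hw x hx)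
      nlinarith [mem_Ioi.1 hx]
    refine ⟨integrableOn_Ioi_deriv_of_nonpos hcont hderiv hnp hlim, ?_⟩
    rw [integral_Ioi_of_hasDerivAt_of_nonpos hcont hderiv hnp hlim, hG0, sub_zero]

theorem stmt_0 (q : ℝ) (hq : q > -(1/2)) (hq0 : q ≠ 0) :
    IntegrableOn (fun x => (1 - Real.exp (-q * x)) * levyDensity x) (Set.Ioi 0) ∧
    ∫ x in Set.Ioi (0:ℝ), (1 - Real.exp (-q * x)) * levyDensity x
      = 2 * Real.sqrt 2 * Real.Gamma (q + 1/2) / Real.Gamma q := by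
  obtain ⟨hi, hv⟩ := integrableOn_and_integral_one_sub_exp_mul hq
  have heq : ∀ x ∈ Set.Ioi (0 : ℝ),
      4 / √(2 * π) * ((1 - exp (-q * x)) * (exp x / (2 * (exp x - 1) * √(exp x - 1)))) =
        (1 - exp (-q * x)) * levyDensity x := fun x hx => by
    rw [levyDensity_eq hx]; ring
  refine ⟨IntegrableOn.congr_fun (hi.const_mul _) heq measurableSet_Ioi, ?_⟩
  rw [← setIntegral_congr_fun measurableSet_Ioi heq, integral_const_mul, hv,
    ProbabilityTheory.beta, show q + 1 / 2 + 1 / 2 = q + 1 by ring, Gamma_add_one hq0,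
    Gamma_one_half_eq, sqrt_mul zero_le_two]
  have hπ : √π ≠ 0 := by positivity
  have h2 : √2 ^ 2 = (2 : ℝ) := sq_sqrt zero_le_two
  have hΓ : Gamma q ≠ 0 := fun h => by
    obtain ⟨m, hm⟩ := Gamma_eq_zero_iff q |>.1 h
    rcases m with _ | m
    · simp at hm; exact hq0 hm
    · push_cast at hm
      linarith [m.cast_nonneg (α := ℝ)]
  field_simp
  rw [h2]
  ring
end

section
/- For every real number q, the function x ↦ (1 − exp(−q·x))·ρ(x) is Lebesgue-integrable on (0, ∞) if and only if q > −1/2. (For q ≤ −1/2 the integrand fails to be integrable at infinity, while for every q ∈ ℝ it is integrable near 0.) -/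
open MeasureTheory Real

theorem measurable_levyDensity : Measurable levyDensity := by
  unfold levyDensity
  fun_prop

theorem levyDensity_nonneg (x : ℝ) : 0 ≤ levyDensity x := by
  unfold levyDensity
  positivity

theorem levyDensity_le_rpow {x : ℝ} (h0 : 0 < x) (h1 : x ≤ 1) :
    levyDensity x ≤ 2 * Real.exp 1 * x ^ (-(3 / 2) : ℝ) := by
  have hx : x ≤ Real.exp x - 1 := by linarith [Real.add_one_le_exp x]
  have hsq : x ^ (3 / 2 : ℝ) ≤ Real.sqrt (2 * Real.pi * (Real.exp x - 1) ^ 3) := by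
    apply Real.le_sqrt_of_sq_le
    have h3 : (x ^ (3 / 2 : ℝ)) ^ 2 = x ^ 3 := by
      rw [← Real.rpow_natCast, ← Real.rpow_mul h0.le, ← Real.rpow_natCast x 3]
      norm_num
    rw [h3]
    have : x ^ 3 ≤ (Real.exp x - 1) ^ 3 := by gcongr
    have h5 : 0 < x ^ 3 := by positivity
    nlinarith [Real.pi_gt_three]
  have hp : 0 < x ^ (3 / 2 : ℝ) := Real.rpow_pos_of_pos h0 _
  unfold levyDensity
  rw [Real.rpow_neg h0.le, ← div_eq_mul_inv]
  gcongr

theorem exp_mul_three_halves_sq (x : ℝ) : Real.exp (3 / 2 * x) ^ 2 = Real.exp x ^ 3 := by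
  rw [← Real.exp_nat_mul, ← Real.exp_nat_mul]
  congr 1
  push_cast
  ring

theorem exp_div_exp_mul_three_halves (x : ℝ) :
    Real.exp x / Real.exp (3 / 2 * x) = Real.exp (-(1 / 2) * x) := by
  rw [← Real.exp_sub]
  congr 1
  ring

theorem levyDensity_le_exp {x : ℝ} (h1 : 1 ≤ x) :
    levyDensity x ≤ 4 * Real.exp (-(1 / 2) * x) := by
  have hx : Real.exp x / 2 ≤ Real.exp x - 1 := by linarith [Real.add_one_le_exp x]
  have hsq : Real.exp (3 / 2 * x) / 2 ≤ Real.sqrt (2 * Real.pi * (Real.exp x - 1) ^ 3) := by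
    apply Real.le_sqrt_of_sq_le
    rw [div_pow, exp_mul_three_halves_sq]
    have : (Real.exp x / 2) ^ 3 ≤ (Real.exp x - 1) ^ 3 := by gcongr
    have h5 : 0 < Real.exp x ^ 3 := by positivity
    rw [div_pow] at this
    nlinarith [Real.pi_gt_three]
  calc levyDensity x ≤ 2 * Real.exp x / (Real.exp (3 / 2 * x) / 2) := by
        unfold levyDensity
        gcongr
    _ = 4 * (Real.exp x / Real.exp (3 / 2 * x)) := by
        field_simp
        norm_num
    _ = _ := by rw [exp_div_exp_mul_three_halves]

theorem exp_le_levyDensity {x : ℝ} (h0 : 0 < x) :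
    2 / 3 * Real.exp (-(1 / 2) * x) ≤ levyDensity x := by
  have hx : 0 < Real.exp x - 1 := by linarith [Real.add_one_le_exp x]
  have hsq : Real.sqrt (2 * Real.pi * (Real.exp x - 1) ^ 3) ≤ 3 * Real.exp (3 / 2 * x) := by
    apply Real.sqrt_le_iff.2 ⟨by positivity, ?_⟩
    rw [mul_pow, exp_mul_three_halves_sq]
    have : (Real.exp x - 1) ^ 3 ≤ Real.exp x ^ 3 := by gcongr; linarith
    have h5 : 0 < (Real.exp x - 1) ^ 3 := by positivity
    nlinarith [Real.pi_lt_four]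
  have hs : 0 < Real.sqrt (2 * Real.pi * (Real.exp x - 1) ^ 3) := by positivity
  calc 2 / 3 * Real.exp (-(1 / 2) * x) = 2 / 3 * (Real.exp x / Real.exp (3 / 2 * x)) := by
        rw [exp_div_exp_mul_three_halves]
    _ = 2 * Real.exp x / (3 * Real.exp (3 / 2 * x)) := by field_simp
    _ ≤ levyDensity x := by
        unfold levyDensity
        gcongr

theorem abs_one_sub_exp_le (y : ℝ) : |1 - Real.exp y| ≤ |y| * Real.exp |y| := by
  have h1 := Real.add_one_le_exp y
  have h2 := Real.add_one_le_exp (-y)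
  have h3 : Real.exp (-y) * Real.exp y = 1 := by rw [← Real.exp_add]; simp
  have h4 := Real.exp_pos y
  rcases le_total 0 y with h | h
  · rw [abs_of_nonneg h, abs_le]
    constructor <;> nlinarith
  · rw [abs_of_nonpos h, abs_le]
    have : 1 ≤ Real.exp (-y) := Real.one_le_exp (by linarith)
    have : Real.exp y ≤ 1 := Real.exp_le_one_iff.2 h
    constructor <;> nlinarith

theorem measurable_one_sub_exp_mul_levyDensity (q : ℝ) :
    Measurable fun x => (1 - Real.exp (-q * x)) * levyDensity x :=
  Measurable.mul (by fun_prop) measurable_levyDensity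

theorem integrableOn_Ioc_one_sub_exp_mul_levyDensity (q : ℝ) :
    IntegrableOn (fun x => (1 - Real.exp (-q * x)) * levyDensity x) (Set.Ioc 0 1) := by
  have hi : IntegrableOn (fun x : ℝ => (|q| * Real.exp |q| * (2 * Real.exp 1)) *
      x ^ (-(1 / 2) : ℝ)) (Set.Ioc 0 1) := by
    apply Integrable.const_mul
    exact (intervalIntegrable_iff_integrableOn_Ioc_of_le zero_le_one).1
      (intervalIntegral.intervalIntegrable_rpow' (by norm_num))
  refine Integrable.mono' hi (measurable_one_sub_exp_mul_levyDensity q).aestronglyMeasurable ?_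
  filter_upwards [ae_restrict_mem measurableSet_Ioc] with x hx
  obtain ⟨h0, h1⟩ := hx
  rw [norm_mul, Real.norm_eq_abs, Real.norm_of_nonneg (levyDensity_nonneg x)]
  have hq : |-q * x| = |q| * x := by rw [abs_mul, abs_neg, abs_of_pos h0]
  have hx' : x ^ (-(1 / 2) : ℝ) = x * x ^ (-(3 / 2) : ℝ) := by
    rw [← Real.rpow_one_add' h0.le (by norm_num)]
    norm_num
  calc |1 - Real.exp (-q * x)| * levyDensity x
      ≤ (|q| * x * Real.exp |q|) * (2 * Real.exp 1 * x ^ (-(3 / 2) : ℝ)) := by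
        gcongr
        · exact levyDensity_nonneg x
        · refine (abs_one_sub_exp_le _).trans ?_
          rw [hq]
          gcongr
          exact mul_le_of_le_one_right (abs_nonneg q) h1
        · exact levyDensity_le_rpow h0 h1
    _ = _ := by
        rw [hx']
        ring

theorem integrableOn_Ioi_one_sub_exp_mul_levyDensity {q : ℝ} (hq : -(1 / 2) < q) :
    IntegrableOn (fun x => (1 - Real.exp (-q * x)) * levyDensity x) (Set.Ioi 1) := by
  have hi : IntegrableOn (fun x : ℝ => 4 * Real.exp (-(1 / 2) * x) +
      4 * Real.exp (-(q + 1 / 2) * x)) (Set.Ioi 1) :=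
    ((exp_neg_integrableOn_Ioi 1 (by norm_num)).const_mul 4).add
      ((exp_neg_integrableOn_Ioi 1 (by linarith)).const_mul 4)
  refine Integrable.mono' hi (measurable_one_sub_exp_mul_levyDensity q).aestronglyMeasurable ?_
  filter_upwards [ae_restrict_mem measurableSet_Ioi] with x hx
  rw [norm_mul, Real.norm_eq_abs, Real.norm_of_nonneg (levyDensity_nonneg x)]
  have he : |1 - Real.exp (-q * x)| ≤ 1 + Real.exp (-q * x) := by
    rw [abs_le]
    constructor <;> linarith [Real.exp_pos (-q * x)]
  calc |1 - Real.exp (-q * x)| * levyDensity x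
      ≤ (1 + Real.exp (-q * x)) * (4 * Real.exp (-(1 / 2) * x)) := by
        gcongr
        · exact levyDensity_nonneg x
        · exact levyDensity_le_exp (le_of_lt hx)
    _ = _ := by
        have : -(q + 1 / 2) * x = -q * x + -(1 / 2) * x := by ring
        rw [this, Real.exp_add]
        ring

theorem not_integrableOn_Ioi_one_sub_exp_mul_levyDensity {q : ℝ} (hq : q ≤ -(1 / 2)) :
    ¬ IntegrableOn (fun x => (1 - Real.exp (-q * x)) * levyDensity x) (Set.Ioi 1) := by
  intro h
  have hc : IntegrableOn (fun _ : ℝ => (1 / 6 : ℝ)) (Set.Ioi 1) := by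
    refine Integrable.mono h aestronglyMeasurable_const ?_
    filter_upwards [ae_restrict_mem measurableSet_Ioi] with x hx
    have hx1 : 1 < x := hx
    have h1 : Real.exp (1 / 2 * x) ≤ Real.exp (-q * x) := Real.exp_le_exp.2 (by nlinarith)
    have h2 := Real.add_one_le_exp (1 / 2 * x)
    have h3 : Real.exp (1 / 2 * x) * Real.exp (-(1 / 2) * x) = 1 := by
      rw [← Real.exp_add]
      ring_nf
      simp
    have h4 : 1 / 4 * Real.exp (1 / 2 * x) ≤ |1 - Real.exp (-q * x)| := by
      rw [abs_sub_comm]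
      refine le_trans ?_ (le_abs_self _)
      linarith
    rw [norm_mul, Real.norm_eq_abs (1 - _), Real.norm_of_nonneg (levyDensity_nonneg x),
      Real.norm_of_nonneg (by norm_num)]
    calc (1 / 6 : ℝ)
        = (1 / 4 * Real.exp (1 / 2 * x)) * (2 / 3 * Real.exp (-(1 / 2) * x)) := by
          linear_combination (-1 / 6) * h3
      _ ≤ _ := by
          gcongr
          exact exp_le_levyDensity (by linarith)
  rw [integrableOn_const_iff] at hc
  norm_num at hc

theorem stmt_1 :
    (∀ q : ℝ,
      IntegrableOn (fun x => (1 - Real.exp (-q * x)) * levyDensity x) (Set.Ioi 0)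
        ↔ q > -(1/2)) ∧
    (∀ q : ℝ,
      IntegrableOn (fun x => (1 - Real.exp (-q * x)) * levyDensity x) (Set.Ioc 0 1)) := by
  refine ⟨fun q => ⟨fun h => ?_, fun hq => ?_⟩, integrableOn_Ioc_one_sub_exp_mul_levyDensity⟩
  · by_contra! hq
    exact not_integrableOn_Ioi_one_sub_exp_mul_levyDensity hq
      (h.mono_set (Set.Ioi_subset_Ioi zero_le_one))
  · rw [← Set.Ioc_union_Ioi_eq_Ioi (zero_le_one' ℝ)]
    exact (integrableOn_Ioc_one_sub_exp_mul_levyDensity q).union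
      (integrableOn_Ioi_one_sub_exp_mul_levyDensity hq)
end

section
/- Define G : (−1/2, ∞) → ℝ by G(q) = Γ(q + 1/2)/Γ(q) for q ≠ 0 and G(0) = 0 (equivalently, G(q) = Γ(q + 1/2) times the reciprocal Gamma function at q, which vanishes at q = 0). Then G is strictly increasing on (−1/2, ∞), G(q) → −∞ as q → (−1/2)⁺, and G(q) → +∞ as q → +∞. -/
open Real

lemma ConvexOn.add_le_add_shift {s : Set ℝ} {f : ℝ → ℝ} (hf : ConvexOn ℝ s f) {x y h : ℝ}
    (hx : x ∈ s) (hyh : y + h ∈ s) (hxy : x ≤ y) (hh : 0 < h) :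
    f (x + h) + f y ≤ f x + f (y + h) := by
  have hd : 0 < y + h - x := by linarith
  have ha : 0 ≤ (y - x) / (y + h - x) := div_nonneg (by linarith) hd.le
  have hb : 0 ≤ h / (y + h - x) := div_nonneg hh.le hd.le
  have hab : (y - x) / (y + h - x) + h / (y + h - x) = 1 := by
    field_simp
    ring
  have h₁ := hf.2 hx hyh ha hb hab
  have h₂ := hf.2 hx hyh hb ha (by rw [add_comm]; exact hab)
  have e₁ : (y - x) / (y + h - x) * x + h / (y + h - x) * (y + h) = x + h := by
    field_simp
    ring
  have e₂ : h / (y + h - x) * x + (y - x) / (y + h - x) * (y + h) = y := by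
    field_simp
    ring
  simp only [smul_eq_mul, e₁, e₂] at h₁ h₂
  linear_combination h₁ + h₂ + (f x + f (y + h)) * hab

lemma monotoneOn_Gamma_add_div_Gamma {h : ℝ} (hh : 0 < h) :
    MonotoneOn (fun x => Gamma (x + h) / Gamma x) (Set.Ioi 0) := by
  intro x hx y hy hxy
  rw [Set.mem_Ioi] at hx hy
  have hΓx := Gamma_pos_of_pos hx
  have hΓy := Gamma_pos_of_pos hy
  have hΓxh := Gamma_pos_of_pos (add_pos hx hh)
  have hΓyh := Gamma_pos_of_pos (add_pos hy hh)
  have key := convexOn_log_Gamma.add_le_add_shift (Set.mem_Ioi.2 hx)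
    (Set.mem_Ioi.2 (add_pos hy hh)) hxy hh
  simp only [Function.comp_apply] at key
  rw [← log_mul hΓxh.ne' hΓy.ne', ← log_mul hΓx.ne' hΓyh.ne',
    log_le_log_iff (by positivity) (by positivity)] at key
  change Gamma (x + h) / Gamma x ≤ Gamma (y + h) / Gamma y
  rw [div_le_div_iff₀ hΓx hΓy]
  linarith

theorem stmt_3 (G : ℝ → ℝ)
    (hG : ∀ q : ℝ, G q = if q = 0 then 0 else Real.Gamma (q + 1/2) / Real.Gamma q) :
    StrictMonoOn G (Set.Ioi (-(1/2) : ℝ)) ∧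
    Filter.Tendsto G (nhdsWithin (-(1/2) : ℝ) (Set.Ioi (-(1/2) : ℝ))) Filter.atBot ∧
    Filter.Tendsto G Filter.atTop Filter.atTop := by
  have hG0 : ∀ q, q ≠ 0 → G q = Gamma (q + 1 / 2) / Gamma q := fun q hq => by
    rw [hG, if_neg hq]
  have hpos : ∀ q, 0 < q → 0 < G q := fun q hq => by
    rw [hG0 q hq.ne']
    exact div_pos (Gamma_pos_of_pos (by linarith)) (Gamma_pos_of_pos hq)
  have hmono : ∀ x y, 0 < x → x ≤ y → G x ≤ G y := fun x y hx hxy => by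
    rw [hG0 x hx.ne', hG0 y (hx.trans_le hxy).ne']
    exact monotoneOn_Gamma_add_div_Gamma one_half_pos hx (hx.trans_le hxy) hxy
  have hhalf : ∀ q, -(1 / 2) < q → G q * G (q + 1 / 2) = q := fun q hq => by
    rcases eq_or_ne q 0 with rfl | hq0
    · simp [hG 0]
    · have hΓ : Gamma (q + 1) = q * Gamma q := Gamma_add_one hq0
      have hp : 0 < Gamma (q + 1) := Gamma_pos_of_pos (by linarith)
      have hne : Gamma q ≠ 0 := fun h0 => by simp [hΓ, h0] at hp
      have hne' : Gamma (q + 1 / 2) ≠ 0 := (Gamma_pos_of_pos (by linarith)).ne'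
      rw [hG0 q hq0, hG0 (q + 1 / 2) (by linarith),
        show q + 1 / 2 + 1 / 2 = q + 1 by ring, hΓ,
        div_mul_div_cancel₀' hne', mul_div_cancel_right₀ _ hne]
  have hone : ∀ q, 0 < q → G q * (q + 1 / 2) = q * G (q + 1) := fun q hq => by
    have h₁ := hhalf q (by linarith)
    have h₂ := hhalf (q + 1 / 2) (by linarith)
    rw [show q + 1 / 2 + 1 / 2 = q + 1 by ring] at h₂
    linear_combination (-G q) * h₂ + G (q + 1) * h₁
  refine ⟨?_, ?_, ?_⟩
  · intro x hx y hy hxy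
    rw [Set.mem_Ioi] at hx hy
    rcases lt_or_ge 0 x with hx0 | hx0
    · have h₁ := hone x hx0
      have h₂ := hone y (hx0.trans hxy)
      have h₃ := hmono (x + 1) (y + 1) (by linarith) (by linarith)
      have h₄ := hpos (x + 1) (by linarith)
      rw [← eq_div_iff (by linarith)] at h₁ h₂
      rw [h₁, h₂, div_lt_div_iff₀ (by linarith) (by linarith)]
      have hy0 : 0 < y * (x + 1 / 2) := mul_pos (hx0.trans hxy) (by linarith)
      nlinarith [mul_le_mul_of_nonneg_left h₃ hy0.le, mul_pos (sub_pos.2 hxy) h₄]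
    · have h₁ := hhalf x hx
      have h₂ := hhalf y hy
      have h₃ := hmono (x + 1 / 2) (y + 1 / 2) (by linarith) (by linarith)
      have h₄ := hpos (x + 1 / 2) (by linarith)
      have h₅ := hpos (y + 1 / 2) (by linarith)
      rw [← eq_div_iff h₄.ne'] at h₁
      rw [← eq_div_iff h₅.ne'] at h₂
      rw [h₁, h₂, div_lt_div_iff₀ h₄ h₅]
      nlinarith [mul_le_mul_of_nonpos_left h₃ hx0, mul_pos (sub_pos.2 hxy) h₄]
  · have hΓ : Gamma (-(1 / 2)) < 0 := by
      have h₁ : Gamma (-(1 / 2) + 1) = -(1 / 2) * Gamma (-(1 / 2)) :=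
        Gamma_add_one (by norm_num)
      have h₂ : 0 < Gamma (-(1 / 2) + 1) := Gamma_pos_of_pos (by norm_num)
      linarith
    have hcont : Filter.Tendsto (fun q => Gamma (q + 3 / 2) / Gamma q)
        (nhdsWithin (-(1 / 2)) (Set.Ioi (-(1 / 2)))) (nhds (1 / Gamma (-(1 / 2)))) := by
      have h₁ : ContinuousAt (fun q : ℝ => Gamma (q + 3 / 2)) (-(1 / 2)) := by
        refine ContinuousAt.comp (g := Gamma) ?_ (by fun_prop)
        refine (differentiableAt_Gamma fun m => ?_).continuousAt
        have : (0 : ℝ) ≤ m := m.cast_nonneg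
        intro h
        linarith
      have h₂ : ContinuousAt Gamma (-(1 / 2)) := by
        refine (differentiableAt_Gamma fun m h => ?_).continuousAt
        have h' : ((2 * m : ℕ) : ℝ) = (1 : ℕ) := by
          push_cast
          linarith
        have := Nat.cast_injective h'
        omega
      have h₃ := (h₁.div h₂ hΓ.ne).tendsto
      norm_num at h₃ ⊢
      exact h₃.mono_left nhdsWithin_le_nhds
    have hinv : Filter.Tendsto (fun q : ℝ => (q + 1 / 2)⁻¹)
        (nhdsWithin (-(1 / 2)) (Set.Ioi (-(1 / 2)))) Filter.atTop := by
      refine tendsto_inv_nhdsGT_zero.comp (tendsto_nhdsWithin_iff.2 ⟨?_, ?_⟩)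
      · have h : ContinuousAt (fun q : ℝ => q + 1 / 2) (-(1 / 2)) := by fun_prop
        have h' := h.tendsto
        norm_num at h' ⊢
        exact h'.mono_left nhdsWithin_le_nhds
      · filter_upwards [self_mem_nhdsWithin] with q hq
        rw [Set.mem_Ioi] at hq ⊢
        linarith
    refine (hinv.atTop_mul_neg (one_div_neg.2 hΓ) hcont).congr' ?_
    filter_upwards [Ioo_mem_nhdsGT (show (-(1 / 2) : ℝ) < 0 by norm_num)] with q hq
    have hq' : q + 1 / 2 ≠ 0 := by linarith [hq.1]
    rw [hG0 q hq.2.ne, show q + 3 / 2 = q + 1 / 2 + 1 by ring, Gamma_add_one hq', mul_div_assoc,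
      inv_mul_cancel_left₀ hq']
  · have hsqrt : Filter.Tendsto (fun q : ℝ => √(q - 1 / 2)) Filter.atTop Filter.atTop :=
      tendsto_sqrt_atTop.comp (Filter.tendsto_atTop_add_const_right _ (-(1 / 2)) Filter.tendsto_id)
    refine Filter.tendsto_atTop_mono' _ ?_ hsqrt
    filter_upwards [Filter.eventually_gt_atTop (1 / 2)] with q hq
    have h₁ := hhalf (q - 1 / 2) (by linarith)
    rw [sub_add_cancel] at h₁
    have h₂ := hmono (q - 1 / 2) q (by linarith) (by linarith)
    have h₃ := hpos q (by linarith)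
    refine sqrt_le_iff.2 ⟨h₃.le, ?_⟩
    nlinarith
end

section
/- For every p ∈ (0,1), the function Φ^S_p is strictly increasing and continuous on (−1/2, ∞), satisfies Φ^S_p(0) = 0, and Φ^S_p(q) → −∞ as q → (−1/2)⁺. -/
open MeasureTheory Real

/-- The Laplace exponent
`Φ^S_p(q) = ∫₀^∞ (1 − exp(−q·x))·(1_{(0, log 2]}(x) + p·1_{(log 2, ∞)}(x))·ρ(x) dx`. -/
noncomputable def PhiS (p q : ℝ) : ℝ :=
  ∫ x in Set.Ioi (0:ℝ), (1 - Real.exp (-q * x)) *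
    ((Set.Ioc (0:ℝ) (Real.log 2)).indicator (fun _ => (1:ℝ)) x
      + p * (Set.Ioi (Real.log 2)).indicator (fun _ => (1:ℝ)) x) * levyDensity x

theorem abs_one_sub_exp_le_s7 {q x δ K : ℝ} (hx : 0 < x) (hδ₀ : 0 ≤ δ) (hδ : δ ≤ 1 / 2)
    (hK : 1 / 2 ≤ K) (h₁ : -(1 / 2) + δ ≤ q) (h₂ : q ≤ K) :
    |1 - exp (-q * x)| ≤ K * x * exp ((1 / 2 - δ) * x) := by
  have hKx : 0 ≤ K * x := by positivity
  rcases le_or_gt 0 q with hq | hq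
  · have h := add_one_le_exp (-q * x)
    have h1 : exp (-q * x) ≤ 1 := exp_le_one_iff.2 (by nlinarith)
    rw [abs_of_nonneg (by linarith)]
    calc 1 - exp (-q * x) ≤ K * x := by nlinarith
      _ ≤ _ := le_mul_of_one_le_right hKx (one_le_exp (by nlinarith))
  · have h := add_one_le_exp (q * x)
    have h1 : 1 ≤ exp (-q * x) := one_le_exp (by nlinarith)
    have h2 : exp (-q * x) ≤ exp ((1 / 2 - δ) * x) := exp_le_exp.2 (by nlinarith)
    have h3 : exp (-q * x) * exp (q * x) = 1 := by rw [← exp_add]; simp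
    rw [abs_of_nonpos (by linarith)]
    calc -(1 - exp (-q * x)) = exp (-q * x) * (1 - exp (q * x)) := by linarith
      _ ≤ exp (-q * x) * (K * x) := by gcongr; nlinarith [mul_nonneg (by linarith : 0 ≤ K + q) hx.le]
      _ ≤ exp ((1 / 2 - δ) * x) * (K * x) := by gcongr
      _ = _ := by ring

theorem levyDensity_pos {x : ℝ} (hx : 0 < x) : 0 < levyDensity x := by
  have : 0 < exp x - 1 := by linarith [add_one_lt_exp hx.ne']
  unfold levyDensity
  positivity

theorem levyDensity_le {x : ℝ} (hx : 0 < x) :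
    levyDensity x ≤ 2 * exp (-(1 / 2) * x) * (1 + x) ^ 2 / (x * √x) := by
  set y := exp (x / 2) with hy
  have hy0 : 0 < y := exp_pos _
  have hyx : exp x = y ^ 2 := by rw [hy, ← exp_nat_mul]; congr 1; push_cast; ring
  have hyi : exp (-(1 / 2) * x) = y⁻¹ := by rw [hy, ← exp_neg]; congr 1; ring
  have hneg : exp (-x) = (y ^ 2)⁻¹ := by rw [exp_neg, hyx]
  have hbase : y ^ 2 * x / (1 + x) ≤ y ^ 2 - 1 := by
    have h := add_one_le_exp x
    rw [hyx] at h
    rw [div_le_iff₀ (by positivity)]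
    nlinarith
  have hs : √x ^ 2 = x := sq_sqrt hx.le
  have hs0 : 0 < √x := sqrt_pos.2 hx
  have hsqrt : y ^ 3 * (x * √x) / (1 + x) ^ 2 ≤ √(2 * π * (y ^ 2 - 1) ^ 3) := by
    apply le_sqrt_of_sq_le
    calc (y ^ 3 * (x * √x) / (1 + x) ^ 2) ^ 2 = y ^ 6 * x ^ 2 * (√x ^ 2) / (1 + x) ^ 4 := by
          field_simp
      _ = y ^ 6 * x ^ 3 / (1 + x) ^ 4 := by rw [hs]; ring
      _ ≤ y ^ 6 * x ^ 3 / (1 + x) ^ 3 := by gcongr <;> linarith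
      _ = (y ^ 2 * x / (1 + x)) ^ 3 := by field_simp
      _ ≤ (y ^ 2 - 1) ^ 3 := by gcongr
      _ ≤ _ := by
        have : 0 ≤ (y ^ 2 - 1) ^ 3 := by
          refine pow_nonneg (le_trans ?_ hbase) 3
          positivity
        nlinarith [pi_gt_three]
  unfold levyDensity
  rw [hyx, hyi]
  calc 2 * y ^ 2 / √(2 * π * (y ^ 2 - 1) ^ 3)
      ≤ 2 * y ^ 2 / (y ^ 3 * (x * √x) / (1 + x) ^ 2) := by gcongr
    _ = _ := by field_simp

theorem le_levyDensity {x : ℝ} (hx : 0 < x) :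
    2 / 3 * exp (-(1 / 2) * x) ≤ levyDensity x := by
  set y := exp (x / 2) with hy
  have hy0 : 0 < y := exp_pos _
  have hyx : exp x = y ^ 2 := by rw [hy, ← exp_nat_mul]; congr 1; push_cast; ring
  have hyi : exp (-(1 / 2) * x) = y⁻¹ := by rw [hy, ← exp_neg]; congr 1; ring
  have h1 : 0 < y ^ 2 - 1 := by rw [← hyx]; linarith [add_one_lt_exp hx.ne']
  have hsqrt : √(2 * π * (y ^ 2 - 1) ^ 3) ≤ 3 * y ^ 3 := by
    apply sqrt_le_iff.2 ⟨by positivity, ?_⟩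
    calc 2 * π * (y ^ 2 - 1) ^ 3 ≤ 9 * (y ^ 2) ^ 3 := by
          gcongr <;> linarith [pi_lt_d2]
      _ = _ := by ring
  unfold levyDensity
  rw [hyx, hyi]
  calc 2 / 3 * y⁻¹ = 2 * y ^ 2 / (3 * y ^ 3) := by field_simp
    _ ≤ _ := by gcongr

/-- The weight `1_{(0, log 2]} + p·1_{(log 2, ∞)}`. -/
noncomputable def cutoffWeight (p x : ℝ) : ℝ :=
  (Set.Ioc (0:ℝ) (Real.log 2)).indicator (fun _ => (1:ℝ)) x
    + p * (Set.Ioi (Real.log 2)).indicator (fun _ => (1:ℝ)) x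

theorem cutoffWeight_mem_Icc {p x : ℝ} (hp : p ≤ 1) (hx : 0 < x) :
    cutoffWeight p x ∈ Set.Icc p 1 := by
  rcases le_or_gt x (log 2) with h | h
  · simp [cutoffWeight, hx, h, hp]
  · simp [cutoffWeight, h, hp]

theorem measurable_cutoffWeight (p : ℝ) : Measurable (cutoffWeight p) :=
  (measurable_const.indicator measurableSet_Ioc).add
    ((measurable_const.indicator measurableSet_Ioi).const_mul p)

theorem integrableOn_exp_mul_sq_div_sqrt {δ : ℝ} (hδ : 0 < δ) :
    IntegrableOn (fun x ↦ exp (-δ * x) * (1 + x) ^ 2 / √x) (Set.Ioi 0) := by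
  have key : ∀ s : ℝ, -1 < s → IntegrableOn (fun x ↦ x ^ s * exp (-δ * x)) (Set.Ioi 0) := by
    intro s hs
    simpa using integrableOn_rpow_mul_exp_neg_mul_rpow hs one_pos hδ
  refine IntegrableOn.congr_fun (((key (-1 / 2) (by norm_num)).add
    ((key (1 / 2) (by norm_num)).const_mul 2)).add (key (3 / 2) (by norm_num))) ?_
    measurableSet_Ioi
  intro x (hx : 0 < x)
  have hs : √x ^ 2 = x := sq_sqrt hx.le
  have hs0 : 0 < √x := sqrt_pos.2 hx
  have e1 : x ^ (-1 / 2 : ℝ) = (√x)⁻¹ := by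
    rw [sqrt_eq_rpow, ← rpow_neg hx.le]; norm_num
  have e2 : x ^ (1 / 2 : ℝ) = √x := (sqrt_eq_rpow x).symm
  have e3 : x ^ (3 / 2 : ℝ) = x * √x := by
    rw [sqrt_eq_rpow, ← rpow_one_add' hx.le (by norm_num)]; norm_num
  simp only [Pi.add_apply, e1, e2, e3]
  field_simp
  rw [hs]
  ring

/-- The integrand of `PhiS`. -/
noncomputable def phiIntegrand (p q x : ℝ) : ℝ :=
  (1 - exp (-q * x)) * cutoffWeight p x * levyDensity x

theorem measurable_phiIntegrand (p q : ℝ) : Measurable (phiIntegrand p q) :=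
  (Measurable.mul (by fun_prop) (measurable_cutoffWeight p)).mul measurable_levyDensity

theorem abs_phiIntegrand_le {p q x δ K : ℝ} (hp : p ∈ Set.Ioo (0:ℝ) 1) (hx : 0 < x)
    (hδ₀ : 0 ≤ δ) (hδ : δ ≤ 1 / 2) (hK : 1 / 2 ≤ K) (h₁ : -(1 / 2) + δ ≤ q) (h₂ : q ≤ K) :
    |phiIntegrand p q x| ≤ 2 * K * (exp (-δ * x) * (1 + x) ^ 2 / √x) := by
  obtain ⟨hw0, hw1⟩ := cutoffWeight_mem_Icc hp.2.le hx
  have hw : 0 ≤ cutoffWeight p x := hp.1.le.trans hw0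
  have hs0 : 0 < √x := sqrt_pos.2 hx
  rw [phiIntegrand, abs_mul, abs_mul, abs_of_nonneg hw, abs_of_pos (levyDensity_pos hx)]
  calc _ ≤ (K * x * exp ((1 / 2 - δ) * x)) * 1 *
        (2 * exp (-(1 / 2) * x) * (1 + x) ^ 2 / (x * √x)) := by
        have := (levyDensity_pos hx).le
        gcongr
        · exact abs_one_sub_exp_le_s7 hx hδ₀ hδ hK h₁ h₂
        · exact levyDensity_le hx
    _ = 2 * K * ((exp ((1 / 2 - δ) * x) * exp (-(1 / 2) * x)) * (1 + x) ^ 2 / √x) := by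
        field_simp
    _ = _ := by rw [← exp_add]; ring_nf

theorem integrableOn_phiIntegrand {p q : ℝ} (hp : p ∈ Set.Ioo (0:ℝ) 1) (hq : -(1 / 2) < q) :
    IntegrableOn (phiIntegrand p q) (Set.Ioi 0) := by
  have hδ : 0 < min (1 / 2) (q + 1 / 2) := lt_min (by norm_num) (by linarith)
  refine ((integrableOn_exp_mul_sq_div_sqrt hδ).const_mul (2 * max (1 / 2) q)).mono'
    (measurable_phiIntegrand p q).aestronglyMeasurable ?_
  filter_upwards [ae_restrict_mem measurableSet_Ioi] with x hx
  exact abs_phiIntegrand_le hp hx hδ.le (min_le_left _ _) (le_max_left _ _)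
    (by linarith [min_le_right (1 / 2) (q + 1 / 2)]) (le_max_right _ _)

theorem phiIntegrand_lt {p q r x : ℝ} (hp : p ∈ Set.Ioo (0:ℝ) 1) (hx : 0 < x) (h : q < r) :
    phiIntegrand p q x < phiIntegrand p r x := by
  have hw : 0 < cutoffWeight p x := hp.1.trans_le (cutoffWeight_mem_Icc hp.2.le hx).1
  have hl := levyDensity_pos hx
  have : exp (-r * x) < exp (-q * x) := exp_lt_exp.2 (by nlinarith)
  unfold phiIntegrand
  gcongr

theorem phiIntegrand_le {p q x : ℝ} (hp : p ∈ Set.Ioo (0:ℝ) 1) (hx : 0 < x) (hq : q ≤ 0) :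
    phiIntegrand p q x ≤ 2 / 3 * p * (exp (-(1 / 2) * x) - exp (-(q + 1 / 2) * x)) := by
  have hw := (cutoffWeight_mem_Icc hp.2.le hx).1
  have h1 : 1 ≤ exp (-q * x) := one_le_exp (by nlinarith)
  have hp0 := hp.1
  have hmul : p * (2 / 3 * exp (-(1 / 2) * x)) ≤ cutoffWeight p x * levyDensity x :=
    mul_le_mul hw (le_levyDensity hx) (by positivity) (hp0.le.trans hw)
  have hexp : exp (-(q + 1 / 2) * x) = exp (-q * x) * exp (-(1 / 2) * x) := by
    rw [← exp_add]; ring_nf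
  rw [hexp]
  unfold phiIntegrand
  nlinarith [mul_le_mul_of_nonneg_left hmul (sub_nonneg.2 h1)]

theorem PhiS_eq_integral_phiIntegrand (p q : ℝ) :
    PhiS p q = ∫ x in Set.Ioi (0:ℝ), phiIntegrand p q x := rfl

theorem strictMonoOn_PhiS {p : ℝ} (hp : p ∈ Set.Ioo (0:ℝ) 1) :
    StrictMonoOn (PhiS p) (Set.Ioi (-(1/2) : ℝ)) := by
  intro q hq r hr hqr
  have iq := integrableOn_phiIntegrand hp hq
  have ir := integrableOn_phiIntegrand hp hr
  rw [PhiS_eq_integral_phiIntegrand, PhiS_eq_integral_phiIntegrand, ← sub_pos,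
    ← integral_sub ir iq]
  have hpos : ∀ x ∈ Set.Ioi (0:ℝ), 0 < phiIntegrand p r x - phiIntegrand p q x :=
    fun x hx ↦ sub_pos.2 (phiIntegrand_lt hp hx hqr)
  refine (setIntegral_pos_iff_support_of_nonneg_ae ?_ (ir.sub iq)).2 ?_
  · filter_upwards [ae_restrict_mem measurableSet_Ioi] with x hx
    exact (hpos x hx).le
  · have : Set.Ioi (0:ℝ) ⊆ Function.support (phiIntegrand p r - phiIntegrand p q) :=
      fun x hx ↦ (hpos x hx).ne'
    exact (by simp : (0 : ENNReal) < volume (Set.Ioi (0:ℝ))).trans_le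
      (measure_mono (Set.subset_inter this subset_rfl))

theorem continuousOn_PhiS {p : ℝ} (hp : p ∈ Set.Ioo (0:ℝ) 1) :
    ContinuousOn (PhiS p) (Set.Ioi (-(1/2) : ℝ)) := by
  intro q hq
  apply ContinuousAt.continuousWithinAt
  have hq' : -(1 / 2) < q := hq
  set δ := min (1 / 2) ((q + 1 / 2) / 2)
  have hδ : 0 < δ := lt_min (by norm_num) (by linarith)
  have hδq : δ ≤ (q + 1 / 2) / 2 := min_le_right _ _
  refine continuousAt_of_dominated
    (F := phiIntegrand p) (μ := volume.restrict (Set.Ioi (0:ℝ)))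
    (bound := fun x ↦ 2 * max (1 / 2) (q + 1) * (exp (-δ * x) * (1 + x) ^ 2 / √x))
    (.of_forall fun r ↦ (measurable_phiIntegrand p r).aestronglyMeasurable) ?_
    ((integrableOn_exp_mul_sq_div_sqrt hδ).const_mul _) (.of_forall fun x ↦ ?_)
  · filter_upwards [Ioo_mem_nhds (by linarith : -(1 / 2) + δ < q) (lt_add_one q)] with r hr
    filter_upwards [ae_restrict_mem measurableSet_Ioi] with x hx
    exact abs_phiIntegrand_le hp hx hδ.le (min_le_left _ _) (le_max_left _ _) hr.1.le
      (hr.2.le.trans (le_max_right _ _))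
  · unfold phiIntegrand
    fun_prop

theorem PhiS_le {p q : ℝ} (hp : p ∈ Set.Ioo (0:ℝ) 1) (hq : -(1 / 2) < q) (hq0 : q ≤ 0) :
    PhiS p q ≤ 2 / 3 * p * (2 - (q + 1 / 2)⁻¹) := by
  have e : ∀ a : ℝ, 0 < a → ∫ x in Set.Ioi (0:ℝ), exp (-a * x) = a⁻¹ := by
    intro a ha
    rw [integral_exp_mul_Ioi (neg_lt_zero.2 ha)]
    simp
  have i : ∀ a : ℝ, 0 < a → IntegrableOn (fun x ↦ exp (-a * x)) (Set.Ioi 0) :=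
    fun a ha ↦ exp_neg_integrableOn_Ioi 0 ha
  have i₁ := i (1 / 2) (by norm_num)
  have i₂ := i (q + 1 / 2) (by linarith)
  calc PhiS p q
      ≤ ∫ x in Set.Ioi (0:ℝ), 2 / 3 * p * (exp (-(1 / 2) * x) - exp (-(q + 1 / 2) * x)) :=
        setIntegral_mono_on (integrableOn_phiIntegrand hp hq) ((i₁.sub i₂).const_mul _)
          measurableSet_Ioi fun x hx ↦ phiIntegrand_le hp hx hq0
    _ = _ := by
        rw [integral_const_mul, integral_sub i₁ i₂, e _ (by norm_num), e _ (by linarith)]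
        norm_num

theorem tendsto_PhiS_atBot {p : ℝ} (hp : p ∈ Set.Ioo (0:ℝ) 1) :
    Filter.Tendsto (PhiS p) (nhdsWithin (-(1/2) : ℝ) (Set.Ioi (-(1/2) : ℝ))) Filter.atBot := by
  have hp0 := hp.1
  have h0 : Filter.Tendsto (fun q : ℝ ↦ q + 1 / 2)
      (nhdsWithin (-(1/2) : ℝ) (Set.Ioi (-(1/2) : ℝ))) (nhdsWithin 0 (Set.Ioi 0)) := by
    refine tendsto_nhdsWithin_iff.2 ⟨?_, ?_⟩
    · have : Filter.Tendsto (fun q : ℝ ↦ q + 1 / 2) (nhds (-(1/2))) (nhds (-(1/2) + 1 / 2)) :=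
        (continuous_id.add continuous_const).tendsto _
      rw [neg_add_cancel] at this
      exact this.mono_left nhdsWithin_le_nhds
    · filter_upwards [self_mem_nhdsWithin] with q hq
      have : -(1 / 2) < q := hq
      exact Set.mem_Ioi.2 (by linarith)
  have h1 : Filter.Tendsto (fun q : ℝ ↦ 2 / 3 * p * (2 - (q + 1 / 2)⁻¹))
      (nhdsWithin (-(1/2) : ℝ) (Set.Ioi (-(1/2) : ℝ))) Filter.atBot := by
    refine Filter.Tendsto.const_mul_atBot (by positivity) ?_
    simp only [sub_eq_add_neg]
    exact Filter.tendsto_atBot_add_const_left _ _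
      (Filter.tendsto_neg_atTop_atBot.comp (tendsto_inv_nhdsGT_zero.comp h0))
  refine Filter.tendsto_atBot_mono' _ ?_ h1
  filter_upwards [Ioo_mem_nhdsGT (by norm_num : (-(1/2) : ℝ) < 0)] with q hq
  exact PhiS_le hp hq.1 hq.2.le

theorem stmt_7 (p : ℝ) (hp : p ∈ Set.Ioo (0:ℝ) 1) :
    StrictMonoOn (PhiS p) (Set.Ioi (-(1/2) : ℝ)) ∧
    ContinuousOn (PhiS p) (Set.Ioi (-(1/2) : ℝ)) ∧
    PhiS p 0 = 0 ∧
    Filter.Tendsto (PhiS p) (nhdsWithin (-(1/2) : ℝ) (Set.Ioi (-(1/2) : ℝ)))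
      Filter.atBot :=
  ⟨strictMonoOn_PhiS hp, continuousOn_PhiS hp, by simp [PhiS], tendsto_PhiS_atBot hp⟩
end

section
/- For every fixed p ∈ (0,1), √β · ∫_β^{−log(1 − exp(−β))} (1−p)·ρ(x) dx → 2(1−p)·√(2/π) as β → 0⁺; that is, Λ^⊖(β, −log(1 − e^{−β})) is asymptotically equivalent to c/√β as β → 0⁺ with c = 2(1−p)·√(2/π). -/
open MeasureTheory Real

lemma hasDerivAt_levyDensity_primitive {x : ℝ} (hx : 0 < x) :
    HasDerivAt (fun y => -(2 * √(2 / π)) * (√(exp y - 1))⁻¹) (levyDensity x) x := by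
  have hu : 0 < exp x - 1 := sub_pos.2 (one_lt_exp_iff.2 hx)
  have hs : 0 < √(exp x - 1) := sqrt_pos.2 hu
  have hd := ((((hasDerivAt_exp x).sub_const 1).sqrt hu.ne').inv hs.ne').const_mul
    (-(2 * √(2 / π)))
  refine hd.congr_deriv ?_
  have hden : √(2 * π * (exp x - 1) ^ 3) = √(2 * π) * √(exp x - 1) ^ 3 := by
    rw [sqrt_mul (by positivity), ← sqrt_sq (pow_pos hs 3).le, ← pow_mul, mul_comm 3 2, pow_mul,
      sq_sqrt hu.le]
  have hc : √(2 / π) * √(2 * π) = 2 := by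
    rw [← sqrt_mul (by positivity), show 2 / π * (2 * π) = 2 ^ 2 by field_simp,
      sqrt_sq zero_le_two]
  have hp : 0 < √(2 * π) := sqrt_pos.2 (by positivity)
  rw [levyDensity, hden]
  field_simp
  linarith

lemma intervalIntegral_levyDensity {a b : ℝ} (ha : 0 < a) (hb : 0 < b) :
    ∫ x in a..b, levyDensity x =
      2 * √(2 / π) * ((√(exp a - 1))⁻¹ - (√(exp b - 1))⁻¹) := by
  have hpos : ∀ x ∈ Set.uIcc a b, 0 < x := fun x hx => (lt_min ha hb).trans_le hx.1
  rw [intervalIntegral.integral_eq_sub_of_hasDerivAt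
    (fun x hx => hasDerivAt_levyDensity_primitive (hpos x hx))]
  · ring
  · refine ContinuousOn.intervalIntegrable fun x hx => ContinuousAt.continuousWithinAt ?_
    have hu : 0 < exp x - 1 := sub_pos.2 (one_lt_exp_iff.2 (hpos x hx))
    have hne : √(2 * π * (exp x - 1) ^ 3) ≠ 0 := (sqrt_pos.2 (by positivity)).ne'
    unfold levyDensity
    exact ContinuousAt.div (by fun_prop) (by fun_prop) hne

lemma exp_neg_log_one_sub_exp_neg {β : ℝ} (hβ : 0 < β) :
    exp (-log (1 - exp (-β))) - 1 = (exp β - 1)⁻¹ := by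
  have h : exp (-β) < 1 := exp_lt_one_iff.2 (neg_lt_zero.2 hβ)
  have hu : exp β - 1 ≠ 0 := (sub_pos.2 (one_lt_exp_iff.2 hβ)).ne'
  rw [exp_neg, exp_log (sub_pos.2 h), exp_neg,
    show 1 - (exp β)⁻¹ = (exp β - 1) / exp β by field_simp]
  field_simp
  ring

lemma tendsto_div_exp_sub_one :
    Filter.Tendsto (fun β : ℝ => β / (exp β - 1)) (nhdsWithin 0 (Set.Ioi 0)) (nhds 1) := by
  have h := (hasDerivAt_iff_tendsto_slope.1 (hasDerivAt_exp 0)).mono_left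
    (nhdsWithin_mono 0 fun x (hx : 0 < x) => hx.ne')
  rw [exp_zero] at h
  have h' := h.inv₀ one_ne_zero
  rw [inv_one] at h'
  refine h'.congr fun x => ?_
  rw [slope_def_field, exp_zero, sub_zero, inv_div]

theorem stmt_14 (p : ℝ) (hp : p ∈ Set.Ioo (0:ℝ) 1) :
    Filter.Tendsto
      (fun β : ℝ => Real.sqrt β *
        ∫ x in β..(-Real.log (1 - Real.exp (-β))), (1 - p) * levyDensity x)
      (nhdsWithin (0:ℝ) (Set.Ioi (0:ℝ)))
      (nhds (2 * (1 - p) * Real.sqrt (2 / Real.pi))) := by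
  have hvanish : Filter.Tendsto (fun β : ℝ => √β * √(exp β - 1))
      (nhdsWithin 0 (Set.Ioi 0)) (nhds 0) := by
    have hc : Continuous fun β : ℝ => √β * √(exp β - 1) := by fun_prop
    simpa using (hc.tendsto 0).mono_left nhdsWithin_le_nhds
  have hlim := (tendsto_div_exp_sub_one.sqrt.sub hvanish).const_mul
    (2 * (1 - p) * √(2 / π))
  rw [sqrt_one, sub_zero, mul_one] at hlim
  refine hlim.congr' ?_
  filter_upwards [self_mem_nhdsWithin] with β (hβ : 0 < β)
  have hupper : 0 < -log (1 - exp (-β)) := by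
    have h : exp (-β) < 1 := exp_lt_one_iff.2 (neg_lt_zero.2 hβ)
    exact neg_pos.2 (log_neg (sub_pos.2 h) (sub_lt_self 1 (exp_pos _)))
  rw [intervalIntegral.integral_const_mul, intervalIntegral_levyDensity hβ hupper,
    exp_neg_log_one_sub_exp_neg hβ, sqrt_inv, inv_inv, sqrt_div hβ.le]
  ring
end

section
/- For every p ∈ (0,1), λ^*(p) > 0; equivalently, β^*(p) := 1 − λ^*(p) < 1. -/
open MeasureTheory Real

/-- The Laplace exponent `Φ(q) = ∫₀^∞ (1 − exp(−q·x))·ρ(x) dx`. -/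
noncomputable def Phi (q : ℝ) : ℝ :=
  ∫ x in Set.Ioi (0:ℝ), (1 - Real.exp (-q * x)) * levyDensity x

theorem stmt_15 (p : ℝ) (hp : p ∈ Set.Ioo (0:ℝ) 1) (kappa : ℝ → ℝ → ℝ)
    (hk : ∀ γ < (0:ℝ), ∀ r ∈ Set.Ioo (1/2 : ℝ) 1, kappa γ r ∈ Set.Ioo (0:ℝ) (1/2) ∧
      Phi (-(kappa γ r)) = -(2 * (1 - p) * (1 - Real.exp γ) * Real.sqrt (2 / Real.pi) *
        (2 * r - 1) / Real.sqrt (r * (1 - r)))) :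
    0 < sSup { x : ℝ | ∃ β ∈ Set.Ioo (0:ℝ) (Real.log 2), ∃ δ > (0:ℝ),
      x = min (β * δ)
        (sSup { y : ℝ | ∃ γ < (0:ℝ), y = γ * δ + kappa γ (Real.exp (-β)) }) } := by
  have hlog : 0 < Real.log 2 := Real.log_pos one_lt_two
  have hr : ∀ β ∈ Set.Ioo (0:ℝ) (Real.log 2), Real.exp (-β) ∈ Set.Ioo (1/2 : ℝ) 1 := by
    intro β hβ
    refine ⟨?_, Real.exp_lt_one_iff.mpr (neg_lt_zero.mpr hβ.1)⟩
    rw [one_div, ← Real.exp_log two_pos, ← Real.exp_neg, Real.exp_lt_exp]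
    exact neg_lt_neg hβ.2
  have hub : ∀ β ∈ Set.Ioo (0:ℝ) (Real.log 2), ∀ δ > (0:ℝ),
      1/2 ∈ upperBounds { y : ℝ | ∃ γ < (0:ℝ), y = γ * δ + kappa γ (Real.exp (-β)) } := by
    rintro β hβ δ hδ _ ⟨γ, hγ, rfl⟩
    have h1 := (hk γ hγ _ (hr β hβ)).1.2
    have h2 := mul_neg_of_neg_of_pos hγ hδ
    linarith
  have hβ : Real.log 2 / 2 ∈ Set.Ioo (0:ℝ) (Real.log 2) := ⟨half_pos hlog, half_lt_self hlog⟩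
  have hκ : 0 < kappa (-1) (Real.exp (-(Real.log 2 / 2))) := (hk (-1) (by norm_num) _ (hr _ hβ)).1.1
  refine lt_csSup_of_lt ⟨1/2, ?_⟩ ⟨_, hβ, _, half_pos hκ, rfl⟩ (lt_min ?_ ?_)
  · rintro _ ⟨β, hβ', δ, hδ, rfl⟩
    exact (min_le_right _ _).trans
      (csSup_le ⟨_, -1, by norm_num, rfl⟩ fun y hy => hub β hβ' δ hδ hy)
  · exact mul_pos (half_pos hlog) (half_pos hκ)
  · exact lt_csSup_of_lt ⟨1/2, hub _ hβ _ (half_pos hκ)⟩ ⟨-1, by norm_num, rfl⟩ (by linarith)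
end
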